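/- arXiv:1203.0097 — 3 statements merged into one kernel-verified Lean document; each statement's English description precedes it below -/
import Mathlib

section
/- Let (Ω,𝓕,P) be a probability space, let 𝓐 and 𝓑 be sub-σ-algebras of 𝓕, and set α(𝓐,𝓑) = sup{|P(A∩B) − P(A)P(B)| : A∈𝓐, B∈𝓑}. There exists a universal constant C > 0 such that: if ξ is an 𝓐-measurable real random variable with E|ξ|^p < ∞ and η is a 𝓑-measurable real random variable with E|η|^q < ∞, where p, q > 0 and 1/p + 1/q < 1, then |E(ξη) − E(ξ)E(η)| ≤ C · (E|ξ|^p)^{1/p} · (E|η|^q)^{1/q} · α(𝓐,𝓑)^{1 − 1/p − 1/q}. -/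
open MeasureTheory ProbabilityTheory Filter

noncomputable section

/-- The strong mixing (α-mixing) coefficient `α(𝓐,𝓑)` between two sub-σ-algebras:
`sup {|P(A∩B) − P(A)P(B)| : A ∈ 𝓐, B ∈ 𝓑}`. -/
def alphaSig {Ω : Type*} [MeasurableSpace Ω] (P : Measure Ω)
    (𝓐 𝓑 : MeasurableSpace Ω) : ℝ :=
  sSup {x : ℝ | ∃ A B : Set Ω, MeasurableSet[𝓐] A ∧ MeasurableSet[𝓑] B ∧
    x = |(P (A ∩ B)).toReal - (P A).toReal * (P B).toReal|}

/-- The σ-algebra `σ(X_t : 1 ≤ t < n)` generated by the past of the process up to time `n`. -/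
def sigLT {Ω : Type*} (X : ℕ → Ω → ℝ) (n : ℕ) : MeasurableSpace Ω :=
  ⨆ t ∈ {t : ℕ | 1 ≤ t ∧ t < n}, MeasurableSpace.comap (X t) inferInstance

/-- The σ-algebra `σ(X_t : t > m)` generated by the future of the process after time `m`. -/
def sigGT {Ω : Type*} (X : ℕ → Ω → ℝ) (m : ℕ) : MeasurableSpace Ω :=
  ⨆ t ∈ {t : ℕ | m < t}, MeasurableSpace.comap (X t) inferInstance

/-- The strong mixing coefficients `α_X(j) = sup_n α(σ(X_t : t < n), σ(X_t : t > n+j))`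
of a process `(X_t)_{t ≥ 1}`. -/
def mixCoef {Ω : Type*} [MeasurableSpace Ω] (P : Measure Ω) (X : ℕ → Ω → ℝ) (j : ℕ) : ℝ :=
  ⨆ n : ℕ, alphaSig P (sigLT X n) (sigGT X (n + j))

/-- Strict stationarity of the process `(X_t)_{t ≥ 1}`: all finite-dimensional
distributions are shift invariant. -/
def IsStrictlyStationary {Ω : Type*} [MeasurableSpace Ω] (P : Measure Ω)
    (X : ℕ → Ω → ℝ) : Prop :=
  ∀ k m : ℕ, Measure.map (fun ω => fun i : Fin m => X (1 + k + i.1) ω) P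
    = Measure.map (fun ω => fun i : Fin m => X (1 + i.1) ω) P

/-- Covariance of two real random variables. -/
def cov {Ω : Type*} [MeasurableSpace Ω] (P : Measure Ω) (U V : Ω → ℝ) : ℝ :=
  (∫ ω, U ω * V ω ∂P) - (∫ ω, U ω ∂P) * ∫ ω, V ω ∂P

/-- The autocovariance `γ(m) = E[X_1 X_{1+m}]` of a (stationary) process. -/
def acov {Ω : Type*} [MeasurableSpace Ω] (P : Measure Ω) (X : ℕ → Ω → ℝ) (m : ℕ) : ℝ :=
  ∫ ω, X 1 ω * X (1 + m) ω ∂P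

/-- The (truncated) sample autocovariance `γ̂_n(m) = (1/n) ∑_{i=1}^{n-m} X_i X_{i+m}`. -/
def hatGamma {Ω : Type*} (X : ℕ → Ω → ℝ) (n m : ℕ) (ω : Ω) : ℝ :=
  (1 / (n : ℝ)) * ∑ i ∈ Finset.Icc 1 (n - m), X i ω * X (i + m) ω

/-- The (untruncated) sample autocovariance `γ̃_n(m) = (1/n) ∑_{t=1}^{n} X_t X_{t+m}`. -/
def tildeGamma {Ω : Type*} (X : ℕ → Ω → ℝ) (n m : ℕ) (ω : Ω) : ℝ :=
  (1 / (n : ℝ)) * ∑ t ∈ Finset.Icc 1 n, X t ω * X (t + m) ω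

/-- The L²(P)-norm of a real random variable. -/
def l2norm {Ω : Type*} [MeasurableSpace Ω] (P : Measure Ω) (U : Ω → ℝ) : ℝ :=
  Real.sqrt (∫ ω, U ω ^ 2 ∂P)

/-- `σ_{h,k}(l)` of the paper (formulas (2.18) and (2.19); they depend on `n`):
`σ_{h,k}(0) = ∑_{t=1}^n {E(X_t X_{t+h} X_t X_{t+k}) − γ(h)γ(k)}` and, for `l ≥ 1`,
`σ_{h,k}(l) = ∑_{t=1}^{n-l} {E(Y¹ₜ) + E(Y²ₜ) − 2γ(h)γ(k)}` where
`Y¹ₜ = X_t X_{t+h} X_{t+l} X_{t+l+k}` and `Y²ₜ = X_{t+l} X_{t+l+h} X_t X_{t+k}`. -/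
def sigmaHK {Ω : Type*} [MeasurableSpace Ω] (P : Measure Ω) (X : ℕ → Ω → ℝ)
    (h k n l : ℕ) : ℝ :=
  if l = 0 then
    ∑ t ∈ Finset.Icc 1 n,
      ((∫ ω, X t ω * X (t + h) ω * X t ω * X (t + k) ω ∂P) - acov P X h * acov P X k)
  else
    ∑ t ∈ Finset.Icc 1 (n - l),
      ((∫ ω, X t ω * X (t + h) ω * X (t + l) ω * X (t + l + k) ω ∂P)
        + (∫ ω, X (t + l) ω * X (t + l + h) ω * X t ω * X (t + k) ω ∂P)
        - 2 * acov P X h * acov P X k)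

/-- The empirical version `σ̄_{h,k}(l)` of the paper (formulas (2.21) and (2.22)). -/
def sigmaBarHK {Ω : Type*} (X : ℕ → Ω → ℝ) (h k n l : ℕ) (ω : Ω) : ℝ :=
  if l = 0 then
    ∑ _t ∈ Finset.Icc 1 n,
      ((1 / (n : ℝ)) * (∑ i ∈ Finset.Icc 1 n, X i ω * X (i + h) ω * X i ω * X (i + k) ω)
        - tildeGamma X n h ω * tildeGamma X n k ω)
  else
    ∑ _t ∈ Finset.Icc 1 (n - l),
      ((1 / (n : ℝ)) * (∑ i ∈ Finset.Icc 1 n,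
          (X i ω * X (i + h) ω * X (i + l) ω * X (i + l + k) ω
            + X (i + l) ω * X (i + l + h) ω * X i ω * X (i + k) ω))
        - 2 * tildeGamma X n h ω * tildeGamma X n k ω)

/-- `θ_n(h,k) = n·Cov(γ̂_n(h), γ̂_n(k))`. -/
def thetaHat {Ω : Type*} [MeasurableSpace Ω] (P : Measure Ω) (X : ℕ → Ω → ℝ)
    (h k n : ℕ) : ℝ :=
  (n : ℝ) * cov P (hatGamma X n h) (hatGamma X n k)

/-- `θ̃_n(h,k) = n·Cov(γ̃_n(h), γ̃_n(k))`. -/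
def thetaTilde {Ω : Type*} [MeasurableSpace Ω] (P : Measure Ω) (X : ℕ → Ω → ℝ)
    (h k n : ℕ) : ℝ :=
  (n : ℝ) * cov P (tildeGamma X n h) (tildeGamma X n k)

/-- The empirical estimator `θ̄_n(h,k) = (1/n) ∑_{l=0}^{h_n} σ̄_{h,k}(l)` (a random variable). -/
def thetaBar {Ω : Type*} (X : ℕ → Ω → ℝ) (h k hn n : ℕ) (ω : Ω) : ℝ :=
  (1 / (n : ℝ)) * ∑ l ∈ Finset.range (hn + 1), sigmaBarHK X h k n l ω

end

/-- Truncation of a real number at level `1`. -/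
noncomputable def unitTrunc (x : ℝ) : ℝ := if |x| ≤ 1 then x else 0

theorem abs_unitTrunc_le_one (x : ℝ) : |unitTrunc x| ≤ 1 := by
  unfold unitTrunc
  split_ifs with h <;> simp [h]

theorem measurable_unitTrunc : Measurable unitTrunc :=
  Measurable.ite (measurableSet_le measurable_norm measurable_const) measurable_id
    measurable_const

/-- A form of Young's inequality with non-conjugate exponents, valid when one factor is
at least `1`. -/
theorem mul_le_rpow_add_rpow_of_one_le {p q s t : ℝ} (hp : 0 < p) (hq : 0 < q)
    (hpq : 1 / p + 1 / q < 1) (hs : 1 ≤ s) (ht : 0 ≤ t) : s * t ≤ s ^ p + t ^ q := by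
  have hp' : 0 < 1 / p := by positivity
  have hq1 : 1 < q := by
    have : 1 / q < 1 := by linarith
    rwa [div_lt_one hq] at this
  have hconj : (q.conjExponent).HolderConjugate q := (Real.HolderConjugate.conjExponent hq1).symm
  have hr1 : 1 < q.conjExponent := hconj.lt
  have hrp : q.conjExponent ≤ p := by
    have h := hconj.inv_add_inv_eq_one
    have h2 : p⁻¹ ≤ (q.conjExponent)⁻¹ := by
      simp only [one_div] at hpq
      linarith
    exact (inv_le_inv₀ hp (by linarith)).mp h2
  have hs0 : 0 ≤ s := by linarith
  calc s * t ≤ s ^ q.conjExponent / q.conjExponent + t ^ q / q :=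
        Real.young_inequality_of_nonneg hs0 ht hconj
    _ ≤ s ^ q.conjExponent + t ^ q :=
        add_le_add (div_le_self (by positivity) hr1.le) (div_le_self (by positivity) hq1.le)
    _ ≤ s ^ p + t ^ q := by
        gcongr

theorem abs_mul_sub_unitTrunc_mul_le {p q : ℝ} (hp : 0 < p) (hq : 0 < q)
    (hpq : 1 / p + 1 / q < 1) (x y : ℝ) :
    |x * y - unitTrunc x * unitTrunc y| ≤ |x| ^ p + |y| ^ q := by
  have key : |x| ≤ 1 ∧ |y| ≤ 1 ∨ |x| * |y| ≤ |x| ^ p + |y| ^ q := by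
    rcases le_total 1 |x| with hx | hx
    · exact .inr (mul_le_rpow_add_rpow_of_one_le hp hq hpq hx (abs_nonneg y))
    rcases le_total 1 |y| with hy | hy
    · right
      rw [mul_comm, add_comm]
      exact mul_le_rpow_add_rpow_of_one_le hq hp (by linarith) hy (abs_nonneg x)
    · exact .inl ⟨hx, hy⟩
  have hnn : 0 ≤ |x| ^ p + |y| ^ q := by positivity
  rcases key with ⟨hx, hy⟩ | h
  · simpa [unitTrunc, hx, hy] using hnn
  · unfold unitTrunc
    split_ifs <;> simpa [abs_mul] using by first | exact h | exact hnn

/-- Replacing both factors of a product by their truncations changes the integral by at most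
the sum of the moments. -/
theorem abs_integral_mul_sub_unitTrunc_mul_le {Ω : Type*} [MeasurableSpace Ω] {μ : Measure Ω}
    [IsProbabilityMeasure μ] {f g : Ω → ℝ} {p q : ℝ} (hp : 0 < p) (hq : 0 < q)
    (hpq : 1 / p + 1 / q < 1) (hf : Measurable f) (hg : Measurable g)
    (hfp : Integrable (fun ω => |f ω| ^ p) μ) (hgq : Integrable (fun ω => |g ω| ^ q) μ) :
    |(∫ ω, f ω * g ω ∂μ) - ∫ ω, unitTrunc (f ω) * unitTrunc (g ω) ∂μ| ≤
      (∫ ω, |f ω| ^ p ∂μ) + ∫ ω, |g ω| ^ q ∂μ := by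
  have hbound := fun ω => abs_mul_sub_unitTrunc_mul_le hp hq hpq (f ω) (g ω)
  have hmT : Measurable fun ω => unitTrunc (f ω) * unitTrunc (g ω) :=
    (measurable_unitTrunc.comp hf).mul (measurable_unitTrunc.comp hg)
  have hT : Integrable (fun ω => unitTrunc (f ω) * unitTrunc (g ω)) μ := by
    refine Integrable.of_bound hmT.aestronglyMeasurable 1 (ae_of_all _ fun ω => ?_)
    rw [Real.norm_eq_abs, abs_mul]
    exact mul_le_one₀ (abs_unitTrunc_le_one _) (abs_nonneg _) (abs_unitTrunc_le_one _)
  have hD : Integrable (fun ω => f ω * g ω - unitTrunc (f ω) * unitTrunc (g ω)) μ :=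
    (hfp.add hgq).mono' ((hf.mul hg).sub hmT).aestronglyMeasurable (ae_of_all _ hbound)
  have hfg : Integrable (fun ω => f ω * g ω) μ := by
    simpa [Pi.add_def] using hD.add hT
  rw [← integral_sub hfg hT, ← integral_add hfp hgq]
  exact (abs_integral_le_integral_abs).trans
    (integral_mono hD.abs (hfp.add hgq) hbound)

/-- If the integrals of `Z` over the sets of a sub-σ-algebra are bounded by `c`, then its integrals
against functions bounded by `1` and measurable for this σ-algebra are bounded by `2 * c`. -/
theorem abs_integral_mul_le_of_forall_setIntegral_le {Ω : Type*} {m m₀ : MeasurableSpace Ω}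
    {μ : Measure Ω} [IsProbabilityMeasure μ] (hm : m ≤ m₀) {X Z : Ω → ℝ} {c : ℝ}
    (hX : Measurable[m] X) (hX1 : ∀ ω, |X ω| ≤ 1) (hZ : Integrable Z μ)
    (hc : ∀ A, MeasurableSet[m] A → |∫ ω in A, Z ω ∂μ| ≤ c) :
    |∫ ω, X ω * Z ω ∂μ| ≤ 2 * c := by
  have hXZ : Integrable (X * Z) μ := by
    refine hZ.abs.mono' ((hX.mono hm le_rfl).aestronglyMeasurable.mul hZ.1)
      (ae_of_all _ fun ω => ?_)
    rw [Pi.mul_apply, Real.norm_eq_abs, abs_mul]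
    exact mul_le_of_le_one_left (abs_nonneg _) (hX1 ω)
  set W : Ω → ℝ := μ[Z | m]
  have hW : Integrable W μ := integrable_condExp
  have hWm : Measurable[m] W := stronglyMeasurable_condExp.measurable
  have hA : MeasurableSet[m] {ω | 0 ≤ W ω} :=
    hWm measurableSet_Ici
  have hpull : ∫ ω, X ω * Z ω ∂μ = ∫ ω, X ω * W ω ∂μ := by
    have h := condExp_mul_of_stronglyMeasurable_left (μ := μ) hX.stronglyMeasurable hXZ hZ
    calc ∫ ω, X ω * Z ω ∂μ = ∫ ω, (μ[X * Z | m]) ω ∂μ := (integral_condExp hm).symm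
      _ = ∫ ω, X ω * W ω ∂μ := integral_congr_ae h
  have hXW : |∫ ω, X ω * W ω ∂μ| ≤ ∫ ω, |W ω| ∂μ := by
    rw [← Real.norm_eq_abs]
    refine norm_integral_le_of_norm_le hW.abs (ae_of_all _ fun ω => ?_)
    rw [Real.norm_eq_abs, abs_mul]
    exact mul_le_of_le_one_left (abs_nonneg _) (hX1 ω)
  have hpos : ∫ ω in {ω | 0 ≤ W ω}, |W ω| ∂μ = ∫ ω in {ω | 0 ≤ W ω}, Z ω ∂μ := by
    rw [← setIntegral_condExp hm hZ hA]
    exact setIntegral_congr_fun (hm _ hA) fun ω hω => abs_of_nonneg hω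
  have hneg : ∫ ω in {ω | 0 ≤ W ω}ᶜ, |W ω| ∂μ = -∫ ω in {ω | 0 ≤ W ω}ᶜ, Z ω ∂μ := by
    rw [← setIntegral_condExp hm hZ hA.compl, ← integral_neg]
    exact setIntegral_congr_fun (hm _ hA.compl) fun ω hω => abs_of_neg (not_le.mp hω)
  have hsplit := integral_add_compl (hm _ hA) hW.abs
  have h1 := (abs_le.mp (hc _ hA)).2
  have h2 := (abs_le.mp (hc _ hA.compl)).1
  rw [hpull]
  linarith

theorem abs_measure_inter_sub_le_alphaSig {Ω : Type*} {𝓐 𝓑 𝓕 : MeasurableSpace Ω}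
    (P : Measure Ω) [IsProbabilityMeasure P] {A B : Set Ω}
    (hA : MeasurableSet[𝓐] A) (hB : MeasurableSet[𝓑] B) :
    |P.real (A ∩ B) - P.real A * P.real B| ≤ alphaSig P 𝓐 𝓑 := by
  refine le_csSup ⟨1, ?_⟩ ⟨A, B, hA, hB, rfl⟩
  rintro x ⟨A, B, -, -, rfl⟩
  have hAB : P.real (A ∩ B) ≤ 1 := measureReal_le_one
  have hAB0 : 0 ≤ P.real (A ∩ B) := measureReal_nonneg
  have hm : P.real A * P.real B ≤ 1 :=
    mul_le_one₀ measureReal_le_one measureReal_nonneg measureReal_le_one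
  have hm0 : 0 ≤ P.real A * P.real B := mul_nonneg measureReal_nonneg measureReal_nonneg
  change |P.real (A ∩ B) - P.real A * P.real B| ≤ 1
  rw [abs_le]
  constructor <;> linarith

theorem alphaSig_nonneg {Ω : Type*} {𝓐 𝓑 𝓕 : MeasurableSpace Ω} (P : Measure Ω) : 0 ≤ alphaSig P 𝓐 𝓑 := by
  refine Real.sSup_nonneg ?_
  rintro x ⟨A, B, -, -, rfl⟩
  exact abs_nonneg _

/-- The covariance inequality for random variables bounded by `1`. -/
theorem abs_cov_le_four_mul_alphaSig {Ω : Type*} {𝓐 𝓑 𝓕 : MeasurableSpace Ω}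
    {P : Measure Ω} [IsProbabilityMeasure P] (h𝓐 : 𝓐 ≤ 𝓕) (h𝓑 : 𝓑 ≤ 𝓕) {X Y : Ω → ℝ}
    (hX : Measurable[𝓐] X) (hY : Measurable[𝓑] Y) (hX1 : ∀ ω, |X ω| ≤ 1)
    (hY1 : ∀ ω, |Y ω| ≤ 1) :
    |(∫ ω, X ω * Y ω ∂P) - (∫ ω, X ω ∂P) * ∫ ω, Y ω ∂P| ≤ 4 * alphaSig P 𝓐 𝓑 := by
  have hXi : Integrable X P :=
    .of_bound (hX.mono h𝓐 le_rfl).aestronglyMeasurable 1 (ae_of_all _ hX1)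
  have hYi : Integrable Y P :=
    .of_bound (hY.mono h𝓑 le_rfl).aestronglyMeasurable 1 (ae_of_all _ hY1)
  have hXY : Integrable (fun ω => X ω * Y ω) P :=
    hYi.bdd_mul hXi.1 (ae_of_all _ hX1)
  have hset : ∀ A, MeasurableSet[𝓐] A →
      |∫ ω in A, (Y ω - ∫ ω, Y ω ∂P) ∂P| ≤ 2 * alphaSig P 𝓐 𝓑 := by
    intro A hA
    have hind : Integrable (A.indicator (1 : Ω → ℝ)) P :=
      (integrable_const (1 : ℝ)).indicator (h𝓐 _ hA)
    have hB : ∀ B, MeasurableSet[𝓑] B →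
        |∫ ω in B, (A.indicator (1 : Ω → ℝ) ω - P.real A) ∂P| ≤ alphaSig P 𝓐 𝓑 := by
      intro B hB
      have h : ∫ ω in B, (A.indicator (1 : Ω → ℝ) ω - P.real A) ∂P
          = P.real (A ∩ B) - P.real A * P.real B := by
        rw [integral_sub hind.integrableOn (integrable_const _),
          integral_indicator_one (h𝓐 _ hA), setIntegral_const, smul_eq_mul,
          measureReal_restrict_apply (h𝓐 _ hA), mul_comm]
      rw [h]
      exact abs_measure_inter_sub_le_alphaSig P hA hB
    have h := abs_integral_mul_le_of_forall_setIntegral_le h𝓑 hY hY1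
      (hind.sub (integrable_const (P.real A))) hB
    convert h using 2
    have hl : ∫ ω in A, (Y ω - ∫ ω, Y ω ∂P) ∂P
        = (∫ ω in A, Y ω ∂P) - P.real A * ∫ ω, Y ω ∂P := by
      rw [integral_sub hYi.integrableOn (integrable_const _), setIntegral_const, smul_eq_mul]
    have hr : ∀ ω, Y ω * (A.indicator (1 : Ω → ℝ) - fun _ => P.real A : Ω → ℝ) ω
        = A.indicator Y ω - P.real A * Y ω := by
      intro ω
      by_cases hω : ω ∈ A <;> simp [hω] <;> ring
    simp_rw [hr]
    rw [hl, integral_sub (hYi.indicator (h𝓐 _ hA)) (hYi.const_mul _),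
      integral_indicator (h𝓐 _ hA), integral_const_mul]
  have h := abs_integral_mul_le_of_forall_setIntegral_le h𝓐 hX hX1
    (hYi.sub (integrable_const (∫ ω, Y ω ∂P))) hset
  have heq : ∫ ω, X ω * (Y - fun _ => ∫ ω, Y ω ∂P : Ω → ℝ) ω ∂P
      = (∫ ω, X ω * Y ω ∂P) - (∫ ω, X ω ∂P) * ∫ ω, Y ω ∂P := by
    simp only [Pi.sub_apply, mul_sub]
    rw [integral_sub hXY (hXi.mul_const _), integral_mul_const]
  rw [heq] at h
  linarith

/-- The covariance inequality for random variables normalized by their moments. -/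
theorem abs_cov_le_of_moments_le {Ω : Type*} {𝓐 𝓑 𝓕 : MeasurableSpace Ω}
    {P : Measure Ω} [IsProbabilityMeasure P] (h𝓐 : 𝓐 ≤ 𝓕) (h𝓑 : 𝓑 ≤ 𝓕) {X Y : Ω → ℝ}
    {p q a : ℝ} (hp : 0 < p) (hq : 0 < q) (hpq : 1 / p + 1 / q < 1)
    (hX : Measurable[𝓐] X) (hY : Measurable[𝓑] Y)
    (hXp : Integrable (fun ω => |X ω| ^ p) P) (hYq : Integrable (fun ω => |Y ω| ^ q) P)
    (hXa : ∫ ω, |X ω| ^ p ∂P ≤ a) (hYa : ∫ ω, |Y ω| ^ q ∂P ≤ a) (ha : alphaSig P 𝓐 𝓑 ≤ a) :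
    |(∫ ω, X ω * Y ω ∂P) - (∫ ω, X ω ∂P) * ∫ ω, Y ω ∂P| ≤ 8 * a := by
  have hX' : Measurable X := hX.mono h𝓐 le_rfl
  have hY' : Measurable Y := hY.mono h𝓑 le_rfl
  have hjoint := abs_integral_mul_sub_unitTrunc_mul_le hp hq hpq hX' hY' hXp hYq
  have hprod := abs_integral_mul_sub_unitTrunc_mul_le (μ := P.prod P) hp hq hpq
    (hX'.comp measurable_fst) (hY'.comp measurable_snd) (hXp.comp_fst P) (hYq.comp_snd P)
  simp only [Function.comp_apply] at hprod
  rw [integral_prod_mul X Y,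
    integral_prod_mul (fun ω => unitTrunc (X ω)) (fun ω => unitTrunc (Y ω)),
    integral_fun_fst (fun ω => |X ω| ^ p), integral_fun_snd (fun ω => |Y ω| ^ q)] at hprod
  simp only [probReal_univ, one_smul] at hprod
  have hbdd := abs_cov_le_four_mul_alphaSig (P := P) h𝓐 h𝓑 (measurable_unitTrunc.comp hX)
    (measurable_unitTrunc.comp hY) (fun _ => abs_unitTrunc_le_one _)
    (fun _ => abs_unitTrunc_le_one _)
  simp only [Function.comp_apply] at hbdd
  rw [abs_le] at *
  constructor <;> linarith [hjoint.1, hjoint.2, hprod.1, hprod.2, hbdd.1, hbdd.2]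

/-- The integral of `|ξ / M| ^ p` for the normalizing constant `M = (m / a) ^ (1 / p)`. -/
theorem integral_abs_div_rpow_le {Ω : Type*} [MeasurableSpace Ω] {P : Measure Ω} {ξ : Ω → ℝ}
    {p m a : ℝ} (hp : 0 < p) (hm : 0 < m) (ha : 0 < a) (hξ : ∫ ω, |ξ ω| ^ p ∂P ≤ m) :
    ∫ ω, |ξ ω / (m / a) ^ (1 / p)| ^ p ∂P ≤ a := by
  have h : ∀ ω, |ξ ω / (m / a) ^ (1 / p)| ^ p = |ξ ω| ^ p / (m / a) := by
    intro ω
    have hM : 0 ≤ (m / a) ^ (1 / p) := by positivity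
    rw [abs_div, abs_of_nonneg hM, Real.div_rpow (abs_nonneg _) hM, ← Real.rpow_mul (by positivity),
      one_div_mul_cancel hp.ne', Real.rpow_one]
  simp_rw [h]
  rw [integral_div, div_le_iff₀ (by positivity), mul_div_cancel₀ _ ha.ne']
  exact hξ

theorem abs_cov_le_of_pos_bounds {Ω : Type*} {𝓐 𝓑 𝓕 : MeasurableSpace Ω}
    {P : Measure Ω} [IsProbabilityMeasure P] (h𝓐 : 𝓐 ≤ 𝓕) (h𝓑 : 𝓑 ≤ 𝓕) {ξ η : Ω → ℝ}
    {p q a m n : ℝ} (hp : 0 < p) (hq : 0 < q) (hpq : 1 / p + 1 / q < 1)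
    (hξ : Measurable[𝓐] ξ) (hη : Measurable[𝓑] η)
    (hξp : Integrable (fun ω => |ξ ω| ^ p) P) (hηq : Integrable (fun ω => |η ω| ^ q) P)
    (hm : 0 < m) (hn : 0 < n) (ha : 0 < a)
    (hξm : ∫ ω, |ξ ω| ^ p ∂P ≤ m) (hηn : ∫ ω, |η ω| ^ q ∂P ≤ n) (hαa : alphaSig P 𝓐 𝓑 ≤ a) :
    |(∫ ω, ξ ω * η ω ∂P) - (∫ ω, ξ ω ∂P) * ∫ ω, η ω ∂P| ≤
      8 * m ^ (1 / p) * n ^ (1 / q) * a ^ (1 - 1 / p - 1 / q) := by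
  have hint : ∀ {ζ : Ω → ℝ} {r M : ℝ}, 0 < M → Integrable (fun ω => |ζ ω| ^ r) P →
      Integrable (fun ω => |ζ ω / M| ^ r) P := by
    intro ζ r M hM hζ
    simp_rw [abs_div, Real.div_rpow (abs_nonneg _) (abs_nonneg M)]
    exact hζ.div_const _
  set M := (m / a) ^ (1 / p) with hMdef
  set N := (n / a) ^ (1 / q) with hNdef
  have hM : 0 < M := by positivity
  have hN : 0 < N := by positivity
  have h := abs_cov_le_of_moments_le h𝓐 h𝓑 hp hq hpq
    (hξ.div_const M) (hη.div_const N)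
    (hint hM hξp) (hint hN hηq) (integral_abs_div_rpow_le hp hm ha hξm)
    (integral_abs_div_rpow_le hq hn ha hηn) hαa
  simp_rw [div_mul_div_comm, integral_div] at h
  rw [div_mul_div_comm, ← sub_div, abs_div, abs_of_pos (mul_pos hM hN),
    div_le_iff₀ (mul_pos hM hN)] at h
  refine h.trans_eq ?_
  rw [hMdef, hNdef, Real.div_rpow hm.le ha.le, Real.div_rpow hn.le ha.le, Real.rpow_sub ha,
    Real.rpow_sub ha, Real.rpow_one]
  field_simp

/-- **Davydov's covariance inequality** (Lemma 1 of the paper).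
There is a universal constant `C > 0` such that for any probability space, any
sub-σ-algebras `𝓐, 𝓑`, any `𝓐`-measurable `ξ` with `E|ξ|^p < ∞` and `𝓑`-measurable `η`
with `E|η|^q < ∞`, where `p, q > 0` and `1/p + 1/q < 1`,
`|E(ξη) − E(ξ)E(η)| ≤ C (E|ξ|^p)^{1/p} (E|η|^q)^{1/q} α(𝓐,𝓑)^{1−1/p−1/q}`. -/
theorem davydov_covariance_inequality :
    ∃ C : ℝ, 0 < C ∧
      ∀ (Ω : Type) (𝓕 : MeasurableSpace Ω) (P : Measure Ω), IsProbabilityMeasure P →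
        ∀ 𝓐 𝓑 : MeasurableSpace Ω, 𝓐 ≤ 𝓕 → 𝓑 ≤ 𝓕 →
          ∀ (ξ η : Ω → ℝ) (p q : ℝ), 0 < p → 0 < q → 1 / p + 1 / q < 1 →
            Measurable[𝓐] ξ → Measurable[𝓑] η →
            Integrable (fun ω => |ξ ω| ^ p) P →
            Integrable (fun ω => |η ω| ^ q) P →
            |(∫ ω, ξ ω * η ω ∂P) - (∫ ω, ξ ω ∂P) * ∫ ω, η ω ∂P| ≤
              C * (∫ ω, |ξ ω| ^ p ∂P) ^ (1 / p) * (∫ ω, |η ω| ^ q ∂P) ^ (1 / q) *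
                (@alphaSig Ω 𝓕 P 𝓐 𝓑) ^ (1 - 1 / p - 1 / q) := by
  refine ⟨8, by norm_num, ?_⟩
  intro Ω 𝓕 P hP 𝓐 𝓑 h𝓐 h𝓑 ξ η p q hp hq hpq hξ hη hξp hηq
  have hθ : 0 < 1 - 1 / p - 1 / q := by linarith
  have hm : 0 ≤ @integral Ω ℝ _ _ 𝓕 P fun ω => |ξ ω| ^ p :=
    integral_nonneg fun ω => by positivity
  have hn : 0 ≤ @integral Ω ℝ _ _ 𝓕 P fun ω => |η ω| ^ q :=
    integral_nonneg fun ω => by positivity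
  have hα := alphaSig_nonneg (𝓐 := 𝓐) (𝓑 := 𝓑) P
  have hlim : ∀ {c r : ℝ}, 0 < r →
      Tendsto (fun ε : ℝ => (c + ε) ^ r) (nhdsWithin 0 (Set.Ioi 0)) (nhds (c ^ r)) := by
    intro c r hr
    have hc : Continuous fun ε : ℝ => (c + ε) ^ r :=
      (continuous_const.add continuous_id).rpow_const fun _ => .inr hr.le
    simpa using (hc.tendsto 0).mono_left nhdsWithin_le_nhds
  refine ge_of_tendsto (((tendsto_const_nhds.mul (hlim (one_div_pos.mpr hp))).mul
    (hlim (one_div_pos.mpr hq))).mul (hlim hθ)) ?_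
  filter_upwards [self_mem_nhdsWithin] with ε (hε : 0 < ε)
  exact abs_cov_le_of_pos_bounds h𝓐 h𝓑 hp hq hpq hξ hη hξp hηq (by linarith) (by linarith)
    (by linarith) (by linarith) (by linarith) (by linarith)
end

section
/- Let (X_t)_{t≥1} be a strictly stationary real-valued process with E(X_t) = 0, and suppose for some δ ∈ (0,∞) that E|X_1|^{2+δ} < ∞ and Σ_{k=1}^{∞} α_X(k)^{δ/(2+δ)} < ∞. Then, with S_n = X_1 + ⋯ + X_n, the sequence (1/n)·E(S_n²) converges as n → ∞; its limit equals γ(0) + 2·Σ_{k=1}^{∞} γ(k), where γ(k) = E[X_1 X_{1+k}] and the series converges absolutely. -/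
open MeasureTheory ProbabilityTheory Filter

namespace StrongMixing

/-- If the integrals of `h` over the sets of a sub-σ-algebra are at most `K`, then the integral of
`h` against a function measurable for that σ-algebra and bounded by `c` is at most `2 * c * K`. -/
lemma abs_integral_mul_le_of_setIntegral_le {Ω : Type*} {m m₀ : MeasurableSpace Ω}
    {P : Measure Ω} [IsFiniteMeasure P] (hm : m ≤ m₀) {f h : Ω → ℝ} {c K : ℝ}
    (hf : Measurable[m] f) (hfc : ∀ ω, |f ω| ≤ c) (hc : 0 ≤ c) (hh : Integrable h P)
    (hK : ∀ A, MeasurableSet[m] A → |∫ ω in A, h ω ∂P| ≤ K) :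
    |∫ ω, f ω * h ω ∂P| ≤ 2 * c * K := by
  set g : Ω → ℝ := P[h | m]
  have hgm : Measurable[m] g := stronglyMeasurable_condExp.measurable
  have hgi : Integrable g P := integrable_condExp
  have hpull : P[f * h | m] =ᵐ[P] f * g :=
    condExp_stronglyMeasurable_mul_of_bound hm hf.stronglyMeasurable hh c (ae_of_all _ hfc)
  have heq : ∫ ω, f ω * h ω ∂P = ∫ ω, f ω * g ω ∂P := by
    exact (integral_condExp hm).symm.trans (integral_congr_ae hpull)
  have hA : MeasurableSet[m] {ω | 0 ≤ g ω} := hgm measurableSet_Ici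
  have habs : ∫ ω, |g ω| ∂P = ∫ ω in {ω | 0 ≤ g ω}, h ω ∂P - ∫ ω in {ω | 0 ≤ g ω}ᶜ, h ω ∂P := by
    rw [← integral_add_compl (hm _ hA) hgi.abs, ← setIntegral_condExp hm hh hA,
      ← setIntegral_condExp hm hh hA.compl, sub_eq_add_neg, ← integral_neg]
    congr 1
    · exact setIntegral_congr_fun (hm _ hA) fun ω hω => abs_of_nonneg hω
    · exact setIntegral_congr_fun (hm _ hA.compl) fun ω hω => abs_of_neg (not_le.mp hω)
  calc |∫ ω, f ω * h ω ∂P| = |∫ ω, f ω * g ω ∂P| := by rw [heq]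
    _ ≤ ∫ ω, c * |g ω| ∂P := by
      refine norm_integral_le_of_norm_le (f := fun ω => f ω * g ω) (hgi.abs.const_mul c)
        (ae_of_all _ fun ω => ?_)
      rw [Real.norm_eq_abs, abs_mul]
      exact mul_le_mul_of_nonneg_right (hfc ω) (abs_nonneg _)
    _ = c * ∫ ω, |g ω| ∂P := integral_const_mul _ _
    _ ≤ c * (K + K) := by
      rw [habs]
      refine mul_le_mul_of_nonneg_left ?_ hc
      linarith [le_of_abs_le (hK _ hA), neg_le_of_abs_le (hK _ hA.compl)]
    _ = 2 * c * K := by ring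

lemma alphaSig_nonneg {Ω : Type*} {𝓐 𝓑 : MeasurableSpace Ω} [MeasurableSpace Ω] (P : Measure Ω) :
    0 ≤ alphaSig P 𝓐 𝓑 := by
  refine Real.sSup_nonneg ?_
  rintro x ⟨A, B, -, -, rfl⟩
  exact abs_nonneg _

section Coefficients

variable {Ω : Type*} {𝓐 𝓑 : MeasurableSpace Ω} [m₀ : MeasurableSpace Ω] {P : Measure Ω}
  [IsProbabilityMeasure P]

lemma abs_measure_inter_sub_mul_le_one (A B : Set Ω) :
    |(P (A ∩ B)).toReal - (P A).toReal * (P B).toReal| ≤ 1 := by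
  simp only [← measureReal_def]
  have h1 : P.real (A ∩ B) ≤ 1 := measureReal_le_one
  have h2 : P.real A ≤ 1 := measureReal_le_one
  have h3 : P.real B ≤ 1 := measureReal_le_one
  have h4 : 0 ≤ P.real (A ∩ B) := measureReal_nonneg
  have h5 : 0 ≤ P.real A := measureReal_nonneg
  have h6 : 0 ≤ P.real B := measureReal_nonneg
  rw [abs_le]
  constructor <;> nlinarith

lemma abs_measure_inter_sub_mul_le_alphaSig {A B : Set Ω}
    (hA : MeasurableSet[𝓐] A) (hB : MeasurableSet[𝓑] B) :
    |(P (A ∩ B)).toReal - (P A).toReal * (P B).toReal| ≤ alphaSig P 𝓐 𝓑 := by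
  refine le_csSup ⟨1, ?_⟩ ⟨A, B, hA, hB, rfl⟩
  rintro x ⟨A, B, -, -, rfl⟩
  exact abs_measure_inter_sub_mul_le_one A B

lemma alphaSig_le_one : alphaSig P 𝓐 𝓑 ≤ 1 := by
  refine Real.sSup_le ?_ zero_le_one
  rintro x ⟨A, B, -, -, rfl⟩
  exact abs_measure_inter_sub_mul_le_one A B

lemma alphaSig_le_mixCoef (X : ℕ → Ω → ℝ) (n j : ℕ) :
    alphaSig P (sigLT X n) (sigGT X (n + j)) ≤ mixCoef P X j :=
  le_ciSup (f := fun n => alphaSig P (sigLT X n) (sigGT X (n + j)))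
    ⟨1, by rintro x ⟨n, rfl⟩; exact alphaSig_le_one⟩ n

/-- The covariance inequality for bounded functions. -/
lemma abs_integral_mul_sub_le_of_bounded (h𝓐 : 𝓐 ≤ m₀) (h𝓑 : 𝓑 ≤ m₀)
    {f g : Ω → ℝ} {c : ℝ} (hc : 0 ≤ c) (hf : Measurable[𝓐] f) (hg : Measurable[𝓑] g)
    (hfc : ∀ ω, |f ω| ≤ c) (hgc : ∀ ω, |g ω| ≤ c) :
    |(∫ ω, f ω * g ω ∂P) - (∫ ω, f ω ∂P) * ∫ ω, g ω ∂P| ≤ 4 * c ^ 2 * alphaSig P 𝓐 𝓑 := by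
  have hfi : Integrable f P :=
    .of_bound (hf.mono h𝓐 le_rfl).aestronglyMeasurable c (ae_of_all _ hfc)
  have hgi : Integrable g P :=
    .of_bound (hg.mono h𝓑 le_rfl).aestronglyMeasurable c (ae_of_all _ hgc)
  have hfgi : Integrable (fun ω => f ω * g ω) P :=
    hgi.bdd_mul hfi.aestronglyMeasurable (ae_of_all _ hfc)
  have hset : ∀ A, MeasurableSet[𝓐] A →
      |∫ ω in A, (g ω - ∫ ω', g ω' ∂P) ∂P| ≤ 2 * c * alphaSig P 𝓐 𝓑 := by
    intro A hA
    have hA₀ := h𝓐 _ hA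
    have hind : Integrable (A.indicator fun _ => (1 : ℝ)) P :=
      (integrable_const 1).indicator hA₀
    have key := abs_integral_mul_le_of_setIntegral_le (P := P) h𝓑 (f := g)
      (h := fun ω => A.indicator (fun _ => (1 : ℝ)) ω - P.real A) (K := alphaSig P 𝓐 𝓑)
      hg hgc hc (hind.sub (integrable_const _)) ?_
    · convert key using 2
      have h1 : ∀ ω, g ω * (A.indicator (fun _ => (1 : ℝ)) ω - P.real A)
          = A.indicator g ω - P.real A * g ω := by
        intro ω
        by_cases hω : ω ∈ A <;> simp [hω] <;> ring
      simp_rw [h1]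
      rw [integral_sub hgi.integrableOn (integrable_const _),
        integral_sub (hgi.indicator hA₀) (hgi.const_mul _), integral_indicator hA₀,
        integral_const_mul]
      simp
    · intro B hB
      have hB₀ := h𝓑 _ hB
      rw [integral_sub hind.integrableOn (integrable_const _), integral_indicator hA₀]
      convert abs_measure_inter_sub_mul_le_alphaSig (P := P) hA hB using 2
      simp [measureReal_def, Measure.restrict_apply hA₀, mul_comm]
  have := abs_integral_mul_le_of_setIntegral_le (P := P) h𝓐 hf hfc hc
    (hgi.sub (integrable_const (∫ ω', g ω' ∂P))) hset
  calc _ = |∫ ω, f ω * (g ω - ∫ ω', g ω' ∂P) ∂P| := by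
        simp_rw [mul_sub]
        rw [integral_sub hfgi (hfi.mul_const _), integral_mul_const]
    _ ≤ _ := this
    _ = _ := by ring

end Coefficients

section Truncation

/-- The real number `x` if `|x| ≤ c`, and `0` otherwise. -/
noncomputable def truncate (c x : ℝ) : ℝ := if |x| ≤ c then x else 0

lemma measurable_truncate (c : ℝ) : Measurable (truncate c) :=
  Measurable.ite (measurableSet_le measurable_norm measurable_const) measurable_id measurable_const

lemma abs_truncate_le {c : ℝ} (hc : 0 ≤ c) (x : ℝ) : |truncate c x| ≤ c := by
  unfold truncate
  split_ifs with h
  · exact h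
  · simpa using hc

lemma sq_le_rpow_mul_rpow_neg {c x δ : ℝ} (hc : 0 < c) (hδ : 0 < δ) (hx : c ≤ x) :
    x ^ 2 ≤ x ^ (2 + δ) * c ^ (-δ) := by
  have hx0 : 0 < x := hc.trans_le hx
  rw [Real.rpow_add hx0, Real.rpow_two, Real.rpow_neg hc.le, mul_assoc]
  refine le_mul_of_one_le_right (sq_nonneg x) ?_
  rw [← div_eq_mul_inv, one_le_div (Real.rpow_pos_of_pos hc δ)]
  exact Real.rpow_le_rpow hc.le hx hδ.le

lemma mul_abs_sub_truncate_le {c δ : ℝ} (hc : 0 < c) (hδ : 0 < δ) (x : ℝ) :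
    c * |x - truncate c x| ≤ |x| ^ (2 + δ) * c ^ (-δ) := by
  unfold truncate
  split_ifs with h
  · simp only [sub_self, abs_zero, mul_zero]
    positivity
  · push Not at h
    rw [sub_zero]
    refine le_trans ?_ (sq_le_rpow_mul_rpow_neg hc hδ h.le)
    nlinarith

lemma abs_mul_sub_truncate_mul_truncate_le {c δ : ℝ} (hc : 0 < c) (hδ : 0 < δ) (x y : ℝ) :
    |x * y - truncate c x * truncate c y| ≤ (|x| ^ (2 + δ) + |y| ^ (2 + δ)) * c ^ (-δ) := by
  have hx0 : 0 ≤ |x| ^ (2 + δ) * c ^ (-δ) := by positivity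
  have hy0 : 0 ≤ |y| ^ (2 + δ) * c ^ (-δ) := by positivity
  rw [add_mul]
  by_cases h : |x| ≤ c ∧ |y| ≤ c
  · simp only [truncate, h.1, h.2, if_true, sub_self, abs_zero]
    positivity
  · have hzero : truncate c x * truncate c y = 0 := by
      unfold truncate
      split_ifs with hx hy <;> simp_all
    rw [hzero, sub_zero, abs_mul]
    have hx' := abs_nonneg x
    have hy' := abs_nonneg y
    rcases le_total |x| |y| with hxy | hxy
    · have : c ≤ |y| := by
        by_contra! hlt
        exact h ⟨hxy.trans hlt.le, hlt.le⟩
      nlinarith [sq_le_rpow_mul_rpow_neg hc hδ this]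
    · have : c ≤ |x| := by
        by_contra! hlt
        exact h ⟨hlt.le, hxy.trans hlt.le⟩
      nlinarith [sq_le_rpow_mul_rpow_neg hc hδ this]

end Truncation

section Davydov

variable {Ω : Type*} {𝓐 𝓑 : MeasurableSpace Ω} [m₀ : MeasurableSpace Ω] {P : Measure Ω}
  [IsProbabilityMeasure P] {U V : Ω → ℝ} {δ M : ℝ}

lemma memLp_two_of_integrable_rpow (hδ : 0 < δ) (hU : AEStronglyMeasurable U P)
    (hUp : Integrable (fun ω => |U ω| ^ (2 + δ)) P) : MemLp U 2 P := by
  rw [memLp_two_iff_integrable_sq hU]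
  refine ((integrable_const 1).add hUp).mono' (hU.pow 2) (ae_of_all _ fun ω => ?_)
  rw [Real.norm_eq_abs, abs_of_nonneg (sq_nonneg _), ← sq_abs]
  rcases le_total |U ω| 1 with h | h
  · have h1 : 0 ≤ |U ω| ^ (2 + δ) := by positivity
    have h2 : |U ω| ^ 2 ≤ 1 := pow_le_one₀ (abs_nonneg _) h
    simpa using h2.trans (by linarith)
  · have h1 : |U ω| ^ 2 ≤ |U ω| ^ (2 + δ) := by
      rw [← Real.rpow_two]
      exact Real.rpow_le_rpow_of_exponent_le h (by linarith)
    simpa using h1.trans (by linarith)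

/-- The covariance inequality with a free truncation level `c`. -/
lemma abs_integral_mul_le_of_truncation_level (h𝓐 : 𝓐 ≤ m₀) (h𝓑 : 𝓑 ≤ m₀) (hδ : 0 < δ)
    (hU : Measurable[𝓐] U) (hV : Measurable[𝓑] V)
    (hUi : Integrable U P) (hU0 : ∫ ω, U ω ∂P = 0)
    (hUp : Integrable (fun ω => |U ω| ^ (2 + δ)) P) (hUM : ∫ ω, |U ω| ^ (2 + δ) ∂P ≤ M)
    (hVp : Integrable (fun ω => |V ω| ^ (2 + δ)) P) (hVM : ∫ ω, |V ω| ^ (2 + δ) ∂P ≤ M)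
    {c : ℝ} (hc : 0 < c) :
    |∫ ω, U ω * V ω ∂P| ≤ 4 * c ^ 2 * alphaSig P 𝓐 𝓑 + 3 * M * c ^ (-δ) := by
  have hU₀ : Measurable U := hU.mono h𝓐 le_rfl
  have hV₀ : Measurable V := hV.mono h𝓑 le_rfl
  set u : Ω → ℝ := fun ω => truncate c (U ω)
  set v : Ω → ℝ := fun ω => truncate c (V ω)
  have hum : Measurable[𝓐] u := (measurable_truncate c).comp hU
  have hvm : Measurable[𝓑] v := (measurable_truncate c).comp hV
  have huc : ∀ ω, |u ω| ≤ c := fun ω => abs_truncate_le hc.le _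
  have hvc : ∀ ω, |v ω| ≤ c := fun ω => abs_truncate_le hc.le _
  have hui : Integrable u P :=
    .of_bound (hum.mono h𝓐 le_rfl).aestronglyMeasurable c (ae_of_all _ huc)
  have hvi : Integrable v P :=
    .of_bound (hvm.mono h𝓑 le_rfl).aestronglyMeasurable c (ae_of_all _ hvc)
  have huvi : Integrable (fun ω => u ω * v ω) P :=
    hvi.bdd_mul hui.aestronglyMeasurable (ae_of_all _ huc)
  have hUVi : Integrable (fun ω => U ω * V ω) P :=
    (memLp_two_of_integrable_rpow hδ hU₀.aestronglyMeasurable hUp).integrable_mul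
      (memLp_two_of_integrable_rpow hδ hV₀.aestronglyMeasurable hVp)
  have hcδ : 0 < c ^ (-δ) := Real.rpow_pos_of_pos hc _
  have hcov := abs_integral_mul_sub_le_of_bounded (P := P) h𝓐 h𝓑 hc.le hum hvm huc hvc
  have hdiff : |∫ ω, (U ω * V ω - u ω * v ω) ∂P| ≤ 2 * M * c ^ (-δ) := by
    calc |∫ ω, (U ω * V ω - u ω * v ω) ∂P|
        ≤ ∫ ω, (|U ω| ^ (2 + δ) + |V ω| ^ (2 + δ)) * c ^ (-δ) ∂P :=
          norm_integral_le_of_norm_le (f := fun ω => U ω * V ω - u ω * v ω)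
            ((hUp.add hVp).mul_const _)
            (ae_of_all _ fun ω => abs_mul_sub_truncate_mul_truncate_le hc hδ _ _)
      _ = (∫ ω, |U ω| ^ (2 + δ) ∂P + ∫ ω, |V ω| ^ (2 + δ) ∂P) * c ^ (-δ) := by
          rw [integral_mul_const, integral_add hUp hVp]
      _ ≤ 2 * M * c ^ (-δ) := mul_le_mul_of_nonneg_right (by linarith) hcδ.le
  have hu0 : c * |∫ ω, u ω ∂P| ≤ M * c ^ (-δ) := by
    have hneg : ∫ ω, c * (U ω - u ω) ∂P = -(c * ∫ ω, u ω ∂P) := by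
      rw [integral_const_mul, integral_sub hUi hui, hU0]
      ring
    calc c * |∫ ω, u ω ∂P| = |∫ ω, c * (U ω - u ω) ∂P| := by
          rw [hneg, abs_neg, abs_mul, abs_of_pos hc]
      _ ≤ ∫ ω, |U ω| ^ (2 + δ) * c ^ (-δ) ∂P := by
          refine norm_integral_le_of_norm_le (f := fun ω => c * (U ω - u ω)) (hUp.mul_const _)
            (ae_of_all _ fun ω => ?_)
          rw [Real.norm_eq_abs, abs_mul, abs_of_pos hc]
          exact mul_abs_sub_truncate_le hc hδ _
      _ ≤ M * c ^ (-δ) := by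
          rw [integral_mul_const]
          exact mul_le_mul_of_nonneg_right hUM hcδ.le
  have hv0 : |∫ ω, v ω ∂P| ≤ c := by
    simpa using norm_integral_le_of_norm_le (f := v) (integrable_const (μ := P) c)
      (ae_of_all _ hvc)
  have hprod : |(∫ ω, u ω ∂P) * ∫ ω, v ω ∂P| ≤ M * c ^ (-δ) := by
    rw [abs_mul]
    refine le_trans ?_ hu0
    rw [mul_comm c]
    exact mul_le_mul_of_nonneg_left hv0 (abs_nonneg _)
  rw [integral_sub hUVi huvi] at hdiff
  rw [abs_le] at *
  constructor <;> linarith [hdiff.1, hdiff.2, hcov.1, hcov.2, hprod.1, hprod.2]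

/-- **Davydov's covariance inequality** for centred variables, in the exponent of a common
moment of order `2 + δ`. -/
lemma abs_integral_mul_le_rpow (h𝓐 : 𝓐 ≤ m₀) (h𝓑 : 𝓑 ≤ m₀) (hδ : 0 < δ)
    (hU : Measurable[𝓐] U) (hV : Measurable[𝓑] V)
    (hUi : Integrable U P) (hU0 : ∫ ω, U ω ∂P = 0)
    (hUp : Integrable (fun ω => |U ω| ^ (2 + δ)) P) (hUM : ∫ ω, |U ω| ^ (2 + δ) ∂P ≤ M)
    (hVp : Integrable (fun ω => |V ω| ^ (2 + δ)) P) (hVM : ∫ ω, |V ω| ^ (2 + δ) ∂P ≤ M) :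
    |∫ ω, U ω * V ω ∂P| ≤ (4 + 3 * M) * alphaSig P 𝓐 𝓑 ^ (δ / (2 + δ)) := by
  have key := fun c hc => abs_integral_mul_le_of_truncation_level (c := c) h𝓐 h𝓑 hδ hU hV hUi hU0
    hUp hUM hVp hVM hc
  have hα : 0 ≤ alphaSig P 𝓐 𝓑 := alphaSig_nonneg P
  generalize alphaSig P 𝓐 𝓑 = a at *
  have hδ2 : 2 + δ ≠ 0 := by positivity
  rcases hα.eq_or_lt with rfl | ha
  · rw [Real.zero_rpow (by positivity), mul_zero]
    have hlim : Tendsto (fun c : ℝ => 4 * c ^ 2 * 0 + 3 * M * c ^ (-δ)) atTop (nhds 0) := by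
      simpa using (tendsto_rpow_neg_atTop hδ).const_mul (3 * M)
    exact ge_of_tendsto hlim ((eventually_gt_atTop 0).mono key)
  · refine (key (a ^ (-(1 / (2 + δ)))) (Real.rpow_pos_of_pos ha _)).trans_eq ?_
    have h1 : (a ^ (-(1 / (2 + δ)))) ^ (-δ) = a ^ (δ / (2 + δ)) := by
      rw [← Real.rpow_mul ha.le]
      congr 1
      field_simp
    have h2 : (a ^ (-(1 / (2 + δ)))) ^ 2 * a = a ^ (δ / (2 + δ)) := by
      rw [← Real.rpow_two, ← Real.rpow_mul ha.le]
      nth_rewrite 2 [← Real.rpow_one a]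
      rw [← Real.rpow_add ha]
      congr 1
      field_simp
      ring
    rw [mul_assoc 4, h1, h2]
    ring

end Davydov

lemma measurable_sigLT {Ω : Type*} {X : ℕ → Ω → ℝ} {t n : ℕ} (ht : 1 ≤ t) (htn : t < n) :
    Measurable[sigLT X n] (X t) :=
  Measurable.of_comap_le <| le_iSup₂_of_le t ⟨ht, htn⟩ le_rfl

lemma measurable_sigGT {Ω : Type*} {X : ℕ → Ω → ℝ} {t n : ℕ} (hnt : n < t) :
    Measurable[sigGT X n] (X t) :=
  Measurable.of_comap_le <| le_iSup₂_of_le t hnt le_rfl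

section Stationary

variable {Ω : Type*} [m₀ : MeasurableSpace Ω] {P : Measure Ω} {X : ℕ → Ω → ℝ}

lemma identDistrib_pair (hmeas : ∀ t, Measurable (X t)) (hstat : IsStrictlyStationary P X)
    (s k : ℕ) :
    IdentDistrib (fun ω => (X (1 + s) ω, X (1 + s + k) ω)) (fun ω => (X 1 ω, X (1 + k) ω)) P P := by
  have h : IdentDistrib (fun ω => fun i : Fin (k + 1) => X (1 + s + i.1) ω)
      (fun ω => fun i : Fin (k + 1) => X (1 + i.1) ω) P P :=
    ⟨(measurable_pi_lambda _ fun i => hmeas _).aemeasurable,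
      (measurable_pi_lambda _ fun i => hmeas _).aemeasurable, hstat s (k + 1)⟩
  simpa [Function.comp_def] using h.comp (u := fun x : Fin (k + 1) → ℝ => (x 0, x (Fin.last k)))
    ((measurable_pi_apply _).prodMk (measurable_pi_apply _))

lemma identDistrib_one (hmeas : ∀ t, Measurable (X t)) (hstat : IsStrictlyStationary P X)
    (s : ℕ) : IdentDistrib (X (1 + s)) (X 1) P P :=
  (identDistrib_pair hmeas hstat s 0).comp measurable_fst

lemma integral_mul_eq_acov (hmeas : ∀ t, Measurable (X t)) (hstat : IsStrictlyStationary P X)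
    (s k : ℕ) : ∫ ω, X (1 + s) ω * X (1 + s + k) ω ∂P = acov P X k :=
  ((identDistrib_pair hmeas hstat s k).comp measurable_mul).integral_eq

lemma sigLT_le (hmeas : ∀ t, Measurable (X t)) (n : ℕ) : sigLT X n ≤ m₀ :=
  iSup₂_le fun t _ => (hmeas t).comap_le

lemma sigGT_le (hmeas : ∀ t, Measurable (X t)) (n : ℕ) : sigGT X n ≤ m₀ :=
  iSup₂_le fun t _ => (hmeas t).comap_le

lemma abs_acov_le [IsProbabilityMeasure P] {δ : ℝ} (hδ : 0 < δ) (hmeas : ∀ t, Measurable (X t))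
    (hstat : IsStrictlyStationary P X)
    (hint : Integrable (X 1) P) (hzero : ∫ ω, X 1 ω ∂P = 0)
    (hmom : Integrable (fun ω => |X 1 ω| ^ (2 + δ)) P) (j : ℕ) :
    |acov P X (j + 2)| ≤
      (4 + 3 * ∫ ω, |X 1 ω| ^ (2 + δ) ∂P) * mixCoef P X j ^ (δ / (2 + δ)) := by
  have hid := (identDistrib_one hmeas hstat (j + 2)).comp
    (u := fun x : ℝ => |x| ^ (2 + δ)) (by fun_prop)
  have hM : 0 ≤ ∫ ω, |X 1 ω| ^ (2 + δ) ∂P := integral_nonneg fun ω => by positivity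
  refine (abs_integral_mul_le_rpow (sigLT_le hmeas 2) (sigGT_le hmeas (2 + j)) hδ
    (measurable_sigLT le_rfl one_lt_two) (measurable_sigGT (by lia)) hint hzero hmom le_rfl
    (hid.integrable_iff.mpr hmom) hid.integral_eq.le).trans ?_
  gcongr
  · exact alphaSig_nonneg P
  · exact alphaSig_le_mixCoef X 2 j

lemma integral_sum_sq_eq (hmeas : ∀ t, Measurable (X t)) (hstat : IsStrictlyStationary P X)
    (hL2 : MemLp (X 1) 2 P) (n : ℕ) :
    ∫ ω, (∑ t ∈ Finset.Icc 1 n, X t ω) ^ 2 ∂P =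
      ∑ i ∈ Finset.range n, (acov P X 0 + 2 * ∑ k ∈ Finset.range i, acov P X (k + 1)) := by
  have hX : ∀ s, MemLp (X (1 + s)) 2 P := fun s =>
    (identDistrib_one hmeas hstat s).memLp_iff.mpr hL2
  have hrange : ∀ n ω, ∑ t ∈ Finset.Icc 1 n, X t ω = ∑ s ∈ Finset.range n, X (1 + s) ω := by
    intro n ω
    rw [← Finset.Ico_add_one_right_eq_Icc, Finset.sum_Ico_eq_sum_range, Nat.add_sub_cancel]
  simp_rw [hrange]
  induction n with
  | zero => simp
  | succ n ih =>
    have hS : MemLp (fun ω => ∑ s ∈ Finset.range n, X (1 + s) ω) 2 P :=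
      memLp_finsetSum _ fun s _ => hX s
    have hcross : ∫ ω, (∑ s ∈ Finset.range n, X (1 + s) ω) * X (1 + n) ω ∂P
        = ∑ k ∈ Finset.range n, acov P X (k + 1) := by
      simp_rw [Finset.sum_mul]
      rw [integral_finsetSum (f := fun s ω => X (1 + s) ω * X (1 + n) ω) _
          fun s _ => (hX s).integrable_mul (hX n),
        ← Finset.sum_range_reflect]
      refine Finset.sum_congr rfl fun s hs => ?_
      have hs' := Finset.mem_range.mp hs
      rw [← integral_mul_eq_acov hmeas hstat (n - 1 - s),
        show 1 + (n - 1 - s) + (s + 1) = 1 + n by lia]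
    have hdiag : ∫ ω, X (1 + n) ω ^ 2 ∂P = acov P X 0 := by
      simpa [sq] using integral_mul_eq_acov hmeas hstat n 0
    have hSX : Integrable
        (fun ω => 2 * ((∑ s ∈ Finset.range n, X (1 + s) ω) * X (1 + n) ω)) P :=
      (hS.integrable_mul (hX n)).const_mul 2
    simp_rw [Finset.sum_range_succ _ n, add_sq, mul_assoc]
    rw [integral_add
        (f := fun ω => (∑ s ∈ Finset.range n, X (1 + s) ω) ^ 2
          + 2 * ((∑ s ∈ Finset.range n, X (1 + s) ω) * X (1 + n) ω))
        (hS.integrable_sq.add hSX) (hX n).integrable_sq,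
      integral_add hS.integrable_sq hSX, integral_const_mul, ih, hcross, hdiag]
    ring

end Stationary

end StrongMixing

/-- **Lemma 2 (convergence form).** For a strictly stationary zero-mean process with
`E|X_1|^{2+δ} < ∞` and `∑_k α_X(k)^{δ/(2+δ)} < ∞`, the sequence `E(S_n²)/n` converges,
its limit being `γ(0) + 2∑_{k≥1} γ(k)` where `γ(k) = E[X_1 X_{1+k}]`, the series
converging absolutely. -/
theorem partial_sum_variance_convergence
    {Ω : Type*} [𝓕 : MeasurableSpace Ω] (P : Measure Ω) [IsProbabilityMeasure P]
    (X : ℕ → Ω → ℝ) (δ : ℝ) (hδ : 0 < δ)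
    (hmeas : ∀ t, Measurable (X t))
    (hstat : IsStrictlyStationary P X)
    (hzero : ∀ t, 1 ≤ t → Integrable (X t) P ∧ (∫ ω, X t ω ∂P) = 0)
    (hmom : Integrable (fun ω => |X 1 ω| ^ (2 + δ)) P)
    (hmix : Summable (fun k : ℕ => mixCoef P X (k + 1) ^ (δ / (2 + δ)))) :
    Summable (fun k : ℕ => |acov P X (k + 1)|) ∧
    Filter.Tendsto
      (fun n : ℕ => (1 / (n : ℝ)) * ∫ ω, (∑ t ∈ Finset.Icc 1 n, X t ω) ^ 2 ∂P)
      Filter.atTop (nhds (acov P X 0 + 2 * ∑' k : ℕ, acov P X (k + 1))) := by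
  have hint := hzero 1 le_rfl
  have hL2 := StrongMixing.memLp_two_of_integrable_rpow hδ (hmeas 1).aestronglyMeasurable hmom
  have hsum : Summable fun k : ℕ => |acov P X (k + 1)| := by
    refine (summable_nat_add_iff 2).mp ?_
    exact (hmix.mul_left _).of_nonneg_of_le (fun _ => abs_nonneg _) fun k =>
      StrongMixing.abs_acov_le hδ hmeas hstat hint.1 hint.2 hmom (k + 1)
  refine ⟨hsum, ?_⟩
  have hlim : Tendsto (fun n => acov P X 0 + 2 * ∑ k ∈ Finset.range n, acov P X (k + 1)) atTop
      (nhds (acov P X 0 + 2 * ∑' k : ℕ, acov P X (k + 1))) :=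
    (hsum.of_abs.hasSum.tendsto_sum_nat.const_mul 2).const_add _
  simpa [StrongMixing.integral_sum_sq_eq hmeas hstat hL2] using hlim.cesaro
end

section
/- Let (X_t)_{t≥1} be a strictly stationary zero-mean strong mixing real process satisfying, for some δ ∈ (0,∞): sup_t E|X_t|^{4+2δ} < ∞ and Σ_{k=1}^{∞} α_X(k)^{δ/(2+δ)} < ∞. Fix an integer h ≥ 0 and define γ̃_n(h) = (1/n)Σ_{t=1}^{n} X_t X_{t+h} and γ(h) = E[X_1 X_{1+h}]. Then E[(γ̃_n(h) − γ(h))²] = O(1/n); that is, there is a constant K with ‖γ̃_n(h) − γ(h)‖_{L²(P)} ≤ K·n^{−1/2} for all n ≥ 1. -/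
open MeasureTheory ProbabilityTheory Filter

theorem cov_comm {Ω : Type*} [MeasurableSpace Ω] (P : Measure Ω) (U V : Ω → ℝ) :
    cov P U V = cov P V U := by
  simp only [cov, mul_comm]

/-- Replacing a bounded `m`-measurable variable by the indicator of a set of `m` costs at most a
factor `2 * M` in the covariance with an integrable variable. -/
theorem exists_abs_cov_le_abs_cov_indicator {Ω : Type*} {m 𝓕 : MeasurableSpace Ω} {P : Measure Ω}
    [IsProbabilityMeasure P] (hm : m ≤ 𝓕) {U V : Ω → ℝ} {M : ℝ} (hU : Measurable[m] U)
    (hUM : ∀ ω, |U ω| ≤ M) (hV : Integrable V P) :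
    ∃ A, MeasurableSet[m] A ∧ |cov P U V| ≤ 2 * M * |cov P (A.indicator 1) V| := by
  set W : Ω → ℝ := fun ω => (P[V|m]) ω - ∫ x, V x ∂P with hW
  have hWm : StronglyMeasurable[m] W := stronglyMeasurable_condExp.sub stronglyMeasurable_const
  have hWi : Integrable W P := integrable_condExp.sub (integrable_const _)
  have hA : MeasurableSet[m] {ω | 0 ≤ W ω} := hWm.measurable measurableSet_Ici
  -- The covariance with `V` of a bounded `m`-measurable variable is its integral against `W`.
  have key : ∀ (Z : Ω → ℝ) (c : ℝ), Measurable[m] Z → (∀ ω, |Z ω| ≤ c) →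
      Integrable (fun ω => Z ω * W ω) P ∧ cov P Z V = ∫ ω, Z ω * W ω ∂P := by
    intro Z c hZ hc
    have hZ' : AEStronglyMeasurable Z P := (hZ.mono hm le_rfl).aestronglyMeasurable
    have hb : ∀ᵐ ω ∂P, ‖Z ω‖ ≤ c := ae_of_all _ hc
    have hZi : Integrable Z P := Integrable.of_bound hZ' c hb
    have hZE : Integrable (fun ω => Z ω * (P[V|m]) ω) P := integrable_condExp.bdd_mul hZ' hb
    have hpull := condExp_stronglyMeasurable_mul_of_bound hm hZ.stronglyMeasurable hV c hb
    have h1 : ∫ ω, Z ω * (P[V|m]) ω ∂P = ∫ ω, Z ω * V ω ∂P := by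
      rw [← integral_condExp hm (f := fun ω => Z ω * V ω)]
      exact (integral_congr_ae hpull).symm
    refine ⟨hWi.bdd_mul hZ' hb, ?_⟩
    simp only [hW, mul_sub]
    rw [integral_sub hZE (hZi.mul_const _), h1, integral_mul_const, cov]
  refine ⟨_, hA, ?_⟩
  have hind : ∀ ω, |Set.indicator {ω | 0 ≤ W ω} (1 : Ω → ℝ) ω| ≤ 1 := fun ω => by
    by_cases h : 0 ≤ W ω <;> simp [h]
  obtain ⟨hi1, hc1⟩ := key _ 1 ((@measurable_one _ _ _ m _).indicator hA) hind
  obtain ⟨hi2, hc2⟩ := key U M hU hUM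
  have hW0 : ∫ ω, W ω ∂P = 0 := by
    simp only [hW]
    rw [integral_sub integrable_condExp (integrable_const _), integral_condExp hm]
    simp
  have habs : ∫ ω, |W ω| ∂P = 2 * cov P (Set.indicator {ω | 0 ≤ W ω} 1) V := by
    have hpt : ∀ ω, |W ω| = 2 * (Set.indicator {ω | 0 ≤ W ω} 1 ω * W ω) - W ω := by
      intro ω
      by_cases h : 0 ≤ W ω
      · simp [h, abs_of_nonneg h]; ring
      · simp [h, abs_of_neg (not_le.mp h)]
    simp_rw [hpt]
    rw [integral_sub (hi1.const_mul 2) hWi, integral_const_mul, hc1, hW0, sub_zero]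
  obtain ⟨ω₀⟩ := P.nonempty_of_neZero
  have hM : 0 ≤ M := (abs_nonneg _).trans (hUM ω₀)
  calc |cov P U V| ≤ ∫ ω, |U ω * W ω| ∂P := by rw [hc2]; exact abs_integral_le_integral_abs
    _ ≤ ∫ ω, M * |W ω| ∂P := by
        refine integral_mono hi2.abs (hWi.abs.const_mul M) fun ω => ?_
        simp only [abs_mul]
        exact mul_le_mul_of_nonneg_right (hUM ω) (abs_nonneg _)
    _ = 2 * M * cov P (Set.indicator {ω | 0 ≤ W ω} 1) V := by
        rw [integral_const_mul, habs]; ring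
    _ ≤ _ := mul_le_mul_of_nonneg_left (le_abs_self _) (by positivity)

/-- Covariance inequality for bounded variables under strong mixing. -/
theorem abs_cov_le_of_bounded {Ω : Type*} {𝓐 𝓑 𝓕 : MeasurableSpace Ω} {P : Measure Ω}
    [IsProbabilityMeasure P] (hA : 𝓐 ≤ 𝓕) (hB : 𝓑 ≤ 𝓕) {a M : ℝ}
    (hmix : ∀ A B, MeasurableSet[𝓐] A → MeasurableSet[𝓑] B →
      |(P (A ∩ B)).toReal - (P A).toReal * (P B).toReal| ≤ a)
    {U V : Ω → ℝ} (hU : Measurable[𝓐] U) (hV : Measurable[𝓑] V)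
    (hUM : ∀ ω, |U ω| ≤ M) (hVM : ∀ ω, |V ω| ≤ M) :
    |cov P U V| ≤ 4 * M ^ 2 * a := by
  obtain ⟨ω₀⟩ := P.nonempty_of_neZero
  have hM : 0 ≤ M := (abs_nonneg _).trans (hUM ω₀)
  have hVi : Integrable V P :=
    Integrable.of_bound (hV.mono hB le_rfl).aestronglyMeasurable M (ae_of_all _ hVM)
  obtain ⟨A, hAm, h1⟩ := exists_abs_cov_le_abs_cov_indicator hA hU hUM hVi
  have hAi : Integrable (A.indicator (1 : Ω → ℝ)) P :=
    (integrable_const (1 : ℝ)).indicator (hA _ hAm)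
  obtain ⟨B, hBm, h2⟩ := exists_abs_cov_le_abs_cov_indicator hB hV hVM hAi
  have h3 : cov P (B.indicator 1) (A.indicator 1)
      = (P (A ∩ B)).toReal - (P A).toReal * (P B).toReal := by
    have e : ∀ ω, B.indicator (1 : Ω → ℝ) ω * A.indicator (1 : Ω → ℝ) ω
        = (A ∩ B).indicator 1 ω := fun ω => by
      by_cases hωA : ω ∈ A <;> by_cases hωB : ω ∈ B <;> simp [hωA, hωB]
    simp only [cov, e]
    rw [integral_indicator_one ((hA _ hAm).inter (hB _ hBm)), integral_indicator_one (hA _ hAm),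
      integral_indicator_one (hB _ hBm), mul_comm (P.real B)]
    rfl
  rw [cov_comm P V, h3] at h2
  calc |cov P U V| ≤ 2 * M * (2 * M * a) := by
        refine h1.trans (mul_le_mul_of_nonneg_left (h2.trans ?_) (by positivity))
        exact mul_le_mul_of_nonneg_left (hmix A B hAm hBm) (by positivity)
    _ = _ := by ring

/-- Truncation of a real number at level `M`. -/
noncomputable def truncAt (M x : ℝ) : ℝ := if |x| ≤ M then x else 0

theorem measurable_truncAt (M : ℝ) : Measurable (truncAt M) :=
  Measurable.ite (measurableSet_le measurable_norm measurable_const) measurable_id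
    measurable_const

theorem abs_truncAt_le {M : ℝ} (hM : 0 ≤ M) (x : ℝ) : |truncAt M x| ≤ M := by
  unfold truncAt
  split_ifs with h
  · exact h
  · simpa using hM

theorem mul_self_le_rpow_mul {M δ z : ℝ} (hM : 0 < M) (hδ : 0 < δ) (hz : M ≤ z) :
    z * z ≤ M ^ (-δ) * z ^ (2 + δ) := by
  have hz0 : 0 < z := hM.trans_le hz
  rw [Real.rpow_add hz0, Real.rpow_two]
  have h1 : 1 ≤ M ^ (-δ) * z ^ δ := by
    rw [Real.rpow_neg hM.le, ← div_eq_inv_mul, one_le_div (Real.rpow_pos_of_pos hM _)]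
    exact Real.rpow_le_rpow hM.le hz hδ.le
  nlinarith [mul_pos hz0 hz0]

theorem abs_mul_sub_truncAt_mul_truncAt_le {M δ : ℝ} (hM : 0 < M) (hδ : 0 < δ) (x y : ℝ) :
    |x * y - truncAt M x * truncAt M y|
      ≤ M ^ (-δ) * (|x| ^ (2 + δ) + |y| ^ (2 + δ)) := by
  have hMδ : 0 < M ^ (-δ) := Real.rpow_pos_of_pos hM _
  have hx := Real.rpow_nonneg (abs_nonneg x) (2 + δ)
  have hy := Real.rpow_nonneg (abs_nonneg y) (2 + δ)
  by_cases h : |x| ≤ M ∧ |y| ≤ M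
  · rw [truncAt, truncAt, if_pos h.1, if_pos h.2, sub_self, abs_zero]
    positivity
  · have hz : truncAt M x * truncAt M y = 0 := by
      rw [not_and_or] at h
      rcases h with h | h <;> simp [truncAt, h]
    rw [hz, sub_zero, abs_mul, mul_add]
    have hx' := mul_nonneg hMδ.le hx
    have hy' := mul_nonneg hMδ.le hy
    rcases le_total |x| |y| with hxy | hxy
    · have := mul_self_le_rpow_mul hM hδ (z := |y|)
        (by by_contra hc; exact h ⟨by linarith, by linarith⟩)
      nlinarith [abs_nonneg y]
    · have := mul_self_le_rpow_mul hM hδ (z := |x|)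
        (by by_contra hc; exact h ⟨by linarith, by linarith⟩)
      nlinarith [abs_nonneg x]

theorem memLp_two_of_integrable_rpow {α : Type*} [MeasurableSpace α] {μ : Measure α}
    [IsFiniteMeasure μ] {δ : ℝ} (hδ : 0 < δ) {f : α → ℝ} (hf : AEStronglyMeasurable f μ)
    (hfi : Integrable (fun x => |f x| ^ (2 + δ)) μ) : MemLp f 2 μ := by
  have h : MemLp f (ENNReal.ofReal (2 + δ)) μ := by
    rw [← integrable_norm_rpow_iff hf (by simp; linarith) ENNReal.ofReal_ne_top,
      ENNReal.toReal_ofReal (by linarith)]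
    exact hfi
  refine h.mono_exponent ?_
  rw [show (2 : ENNReal) = ENNReal.ofReal 2 by simp]
  exact ENNReal.ofReal_le_ofReal (by linarith)

theorem abs_integral_mul_sub_integral_truncAt_le {α : Type*} [MeasurableSpace α] {μ : Measure α}
    [IsFiniteMeasure μ] {M δ : ℝ} (hM : 0 < M) (hδ : 0 < δ) {f g : α → ℝ} (hf : Measurable f)
    (hg : Measurable g) (hfi : Integrable (fun x => |f x| ^ (2 + δ)) μ)
    (hgi : Integrable (fun x => |g x| ^ (2 + δ)) μ) :
    |(∫ x, f x * g x ∂μ) - ∫ x, truncAt M (f x) * truncAt M (g x) ∂μ|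
      ≤ M ^ (-δ) * ((∫ x, |f x| ^ (2 + δ) ∂μ) + ∫ x, |g x| ^ (2 + δ) ∂μ) := by
  have h1 : Integrable (fun x => f x * g x) μ :=
    (memLp_two_of_integrable_rpow hδ hf.aestronglyMeasurable hfi).integrable_mul
      (memLp_two_of_integrable_rpow hδ hg.aestronglyMeasurable hgi)
  have h2 : Integrable (fun x => truncAt M (f x) * truncAt M (g x)) μ := by
    refine Integrable.of_bound (((measurable_truncAt M).comp hf).mul
      ((measurable_truncAt M).comp hg)).aestronglyMeasurable (M * M) (ae_of_all _ fun x => ?_)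
    rw [Real.norm_eq_abs, abs_mul]
    exact mul_le_mul (abs_truncAt_le hM.le _) (abs_truncAt_le hM.le _) (abs_nonneg _) hM.le
  rw [← integral_sub h1 h2, ← integral_add hfi hgi, ← integral_const_mul]
  refine abs_integral_le_integral_abs.trans
    (integral_mono (h1.sub h2).abs ((hfi.add hgi).const_mul _) fun x => ?_)
  exact abs_mul_sub_truncAt_mul_truncAt_le hM hδ _ _

/-- Davydov covariance inequality with equal moment exponents `2 + δ`. -/
theorem abs_cov_le_rpow {Ω : Type*} {𝓐 𝓑 𝓕 : MeasurableSpace Ω} {P : Measure Ω}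
    [IsProbabilityMeasure P] (hA : 𝓐 ≤ 𝓕) (hB : 𝓑 ≤ 𝓕) {a δ C : ℝ} (ha : 0 ≤ a) (hδ : 0 < δ)
    (hmix : ∀ A B, MeasurableSet[𝓐] A → MeasurableSet[𝓑] B →
      |(P (A ∩ B)).toReal - (P A).toReal * (P B).toReal| ≤ a)
    {U V : Ω → ℝ} (hU : Measurable[𝓐] U) (hV : Measurable[𝓑] V)
    (hUi : Integrable (fun ω => |U ω| ^ (2 + δ)) P) (hUC : ∫ ω, |U ω| ^ (2 + δ) ∂P ≤ C)
    (hVi : Integrable (fun ω => |V ω| ^ (2 + δ)) P) (hVC : ∫ ω, |V ω| ^ (2 + δ) ∂P ≤ C) :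
    |cov P U V| ≤ 4 * (1 + C) * a ^ (δ / (2 + δ)) := by
  have hp : 0 < 2 + δ := by linarith
  have hU' : Measurable U := hU.mono hA le_rfl
  have hV' : Measurable V := hV.mono hB le_rfl
  have hpos : ∀ b, a ≤ b → 0 < b → |cov P U V| ≤ 4 * (1 + C) * b ^ (δ / (2 + δ)) := by
    intro b hab hb
    set M : ℝ := b ^ (-(1 / (2 + δ))) with hMdef
    have hM : 0 < M := Real.rpow_pos_of_pos hb _
    have hMδ : M ^ (-δ) = b ^ (δ / (2 + δ)) := by
      rw [hMdef, ← Real.rpow_mul hb.le]; congr 1; field_simp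
    have hMb : M ^ 2 * b = b ^ (δ / (2 + δ)) := by
      rw [hMdef, ← Real.rpow_natCast, ← Real.rpow_mul hb.le]
      nth_rw 2 [← Real.rpow_one b]
      rw [← Real.rpow_add hb]
      congr 1; push_cast; field_simp; ring
    have hbdd := abs_cov_le_of_bounded hA hB hmix ((measurable_truncAt M).comp hU)
      ((measurable_truncAt M).comp hV) (fun ω => abs_truncAt_le hM.le (U ω))
      (fun ω => abs_truncAt_le hM.le (V ω))
    have h1 := abs_integral_mul_sub_integral_truncAt_le hM hδ hU' hV' hUi hVi
    have h2 := abs_integral_mul_sub_integral_truncAt_le (μ := P.prod P) hM hδ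
      (hU'.comp measurable_fst) (hV'.comp measurable_snd) (hUi.comp_fst P) (hVi.comp_snd P)
    simp only [Function.comp_apply] at h2
    rw [integral_prod_mul, integral_prod_mul (fun ω => truncAt M (U ω)) fun ω => truncAt M (V ω),
      integral_fun_fst (fun ω => |U ω| ^ (2 + δ)), integral_fun_snd (fun ω => |V ω| ^ (2 + δ))] at h2
    simp only [probReal_univ, one_smul] at h2
    have hsum : M ^ (-δ) * ((∫ ω, |U ω| ^ (2 + δ) ∂P) + ∫ ω, |V ω| ^ (2 + δ) ∂P)
        ≤ b ^ (δ / (2 + δ)) * (C + C) := by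
      rw [hMδ]; gcongr
    have hab' : 4 * M ^ 2 * a ≤ 4 * b ^ (δ / (2 + δ)) := by
      rw [← hMb]; nlinarith [sq_nonneg M]
    simp only [cov, Function.comp_apply] at hbdd ⊢
    rw [abs_le] at *
    constructor <;> linarith [h1.1, h1.2, h2.1, h2.2, hbdd.1, hbdd.2]
  rcases ha.lt_or_eq with ha' | ha'
  · exact hpos a le_rfl ha'
  · have hθ : 0 < δ / (2 + δ) := by positivity
    have hcont : Tendsto (fun b : ℝ => 4 * (1 + C) * b ^ (δ / (2 + δ))) (nhdsWithin a (Set.Ioi a))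
        (nhds (4 * (1 + C) * a ^ (δ / (2 + δ)))) :=
      ((Real.continuousAt_rpow_const a _ (Or.inr hθ.le)).tendsto.mono_left
        nhdsWithin_le_nhds).const_mul _
    refine ge_of_tendsto hcont ?_
    filter_upwards [self_mem_nhdsWithin] with b hb
    exact hpos b (le_of_lt hb) (ha.trans_lt hb)

theorem abs_measure_inter_sub_mul_le_one {Ω : Type*} [MeasurableSpace Ω] (P : Measure Ω)
    [IsProbabilityMeasure P] (A B : Set Ω) :
    |(P (A ∩ B)).toReal - (P A).toReal * (P B).toReal| ≤ 1 := by
  have h1 : (P (A ∩ B)).toReal ≤ 1 := measureReal_le_one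
  have h2 : (P A).toReal ≤ 1 := measureReal_le_one
  have h3 : (P B).toReal ≤ 1 := measureReal_le_one
  have h4 : 0 ≤ (P A).toReal * (P B).toReal := by positivity
  have h5 : (P A).toReal * (P B).toReal ≤ 1 := mul_le_one₀ h2 ENNReal.toReal_nonneg h3
  rw [abs_le]
  constructor <;> linarith [ENNReal.toReal_nonneg (a := P (A ∩ B))]

theorem alphaSig_le_one {Ω : Type*} (𝓐 𝓑 : MeasurableSpace Ω) [MeasurableSpace Ω]
    (P : Measure Ω) [IsProbabilityMeasure P] : alphaSig P 𝓐 𝓑 ≤ 1 := by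
  refine Real.sSup_le ?_ zero_le_one
  rintro x ⟨A, B, -, -, rfl⟩
  exact abs_measure_inter_sub_mul_le_one P A B

theorem abs_measure_inter_sub_mul_le_mixCoef {Ω : Type*} [MeasurableSpace Ω] (P : Measure Ω)
    [IsProbabilityMeasure P] (X : ℕ → Ω → ℝ) (n j : ℕ) {A B : Set Ω}
    (hA : MeasurableSet[sigLT X n] A) (hB : MeasurableSet[sigGT X (n + j)] B) :
    |(P (A ∩ B)).toReal - (P A).toReal * (P B).toReal| ≤ mixCoef P X j := by
  have h1 : |(P (A ∩ B)).toReal - (P A).toReal * (P B).toReal|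
      ≤ alphaSig P (sigLT X n) (sigGT X (n + j)) := by
    refine le_csSup ⟨1, ?_⟩ ⟨A, B, hA, hB, rfl⟩
    rintro x ⟨A, B, -, -, rfl⟩
    exact abs_measure_inter_sub_mul_le_one P A B
  refine h1.trans (le_ciSup (f := fun n => alphaSig P (sigLT X n) (sigGT X (n + j))) ⟨1, ?_⟩ n)
  rintro x ⟨k, rfl⟩
  exact alphaSig_le_one _ _ P

theorem mixCoef_nonneg {Ω : Type*} [MeasurableSpace Ω] (P : Measure Ω)
    [IsProbabilityMeasure P] (X : ℕ → Ω → ℝ) (j : ℕ) : 0 ≤ mixCoef P X j :=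
  (abs_nonneg _).trans (abs_measure_inter_sub_mul_le_mixCoef P X 0 j
    (@MeasurableSet.empty _ (sigLT X 0)) (@MeasurableSet.empty _ (sigGT X (0 + j))))

theorem sigLT_le {Ω : Type*} [𝓕 : MeasurableSpace Ω] {X : ℕ → Ω → ℝ}
    (hX : ∀ t, Measurable (X t)) (n : ℕ) : sigLT X n ≤ 𝓕 :=
  iSup₂_le fun t _ => (hX t).comap_le

theorem sigGT_le {Ω : Type*} [𝓕 : MeasurableSpace Ω] {X : ℕ → Ω → ℝ}
    (hX : ∀ t, Measurable (X t)) (n : ℕ) : sigGT X n ≤ 𝓕 :=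
  iSup₂_le fun t _ => (hX t).comap_le

theorem measurable_sigLT {Ω : Type*} (X : ℕ → Ω → ℝ) {n t : ℕ} (h1 : 1 ≤ t) (ht : t < n) :
    Measurable[sigLT X n] (X t) :=
  Measurable.of_comap_le (le_iSup₂_of_le (f := fun (t : ℕ) (_ : t ∈ {t : ℕ | 1 ≤ t ∧ t < n}) =>
    MeasurableSpace.comap (X t) inferInstance) t ⟨h1, ht⟩ le_rfl)

theorem measurable_sigGT {Ω : Type*} (X : ℕ → Ω → ℝ) {n t : ℕ} (ht : n < t) :
    Measurable[sigGT X n] (X t) :=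
  Measurable.of_comap_le (le_iSup₂_of_le (f := fun (t : ℕ) (_ : t ∈ {t : ℕ | n < t}) =>
    MeasurableSpace.comap (X t) inferInstance) t ht le_rfl)

theorem integral_mul_eq_acov {Ω : Type*} [MeasurableSpace Ω] {P : Measure Ω} {X : ℕ → Ω → ℝ}
    (hX : ∀ t, Measurable (X t)) (hstat : IsStrictlyStationary P X) (h : ℕ) {t : ℕ}
    (ht : 1 ≤ t) : ∫ ω, X t ω * X (t + h) ω ∂P = acov P X h := by
  obtain ⟨k, rfl⟩ := Nat.exists_eq_add_of_le ht
  have hg : Measurable fun v : Fin (h + 1) → ℝ => v 0 * v (Fin.last h) := by fun_prop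
  have hmap : ∀ k : ℕ, ∫ v, v 0 * v (Fin.last h) ∂(Measure.map
      (fun ω => fun i : Fin (h + 1) => X (1 + k + i.1) ω) P)
      = ∫ ω, X (1 + k) ω * X (1 + k + h) ω ∂P := fun k => by
    rw [integral_map (measurable_pi_lambda _ fun i => hX _).aemeasurable hg.aestronglyMeasurable]
    simp
  rw [← hmap k, hstat k (h + 1)]
  exact hmap 0

theorem integrable_rpow_abs_mul {Ω : Type*} [MeasurableSpace Ω] {P : Measure Ω} {Y Z : Ω → ℝ}
    {δ B : ℝ} (hY : Measurable Y) (hZ : Measurable Z)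
    (hYi : Integrable (fun ω => |Y ω| ^ (4 + 2 * δ)) P)
    (hYB : ∫ ω, |Y ω| ^ (4 + 2 * δ) ∂P ≤ B)
    (hZi : Integrable (fun ω => |Z ω| ^ (4 + 2 * δ)) P)
    (hZB : ∫ ω, |Z ω| ^ (4 + 2 * δ) ∂P ≤ B) :
    Integrable (fun ω => |Y ω * Z ω| ^ (2 + δ)) P ∧ ∫ ω, |Y ω * Z ω| ^ (2 + δ) ∂P ≤ B := by
  have hsq : ∀ x : ℝ, |x| ^ (4 + 2 * δ) = (|x| ^ (2 + δ)) ^ 2 := fun x => by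
    rw [← Real.rpow_natCast, ← Real.rpow_mul (abs_nonneg x)]
    congr 1; push_cast; ring
  have hpt : ∀ ω, |Y ω * Z ω| ^ (2 + δ)
      ≤ 2⁻¹ * (|Y ω| ^ (4 + 2 * δ) + |Z ω| ^ (4 + 2 * δ)) := fun ω => by
    rw [abs_mul, Real.mul_rpow (abs_nonneg _) (abs_nonneg _), hsq, hsq]
    linarith [two_mul_le_add_sq (|Y ω| ^ (2 + δ)) (|Z ω| ^ (2 + δ))]
  have hdom := (hYi.add hZi).const_mul 2⁻¹
  have hint : Integrable (fun ω => |Y ω * Z ω| ^ (2 + δ)) P := by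
    refine hdom.mono' (by fun_prop : Measurable _).aestronglyMeasurable
      (ae_of_all _ fun ω => ?_)
    rw [Real.norm_of_nonneg (Real.rpow_nonneg (abs_nonneg _) _)]
    exact hpt ω
  refine ⟨hint, (integral_mono hint hdom hpt).trans ?_⟩
  simp only [Pi.add_apply]
  rw [integral_const_mul, integral_add hYi hZi]
  linarith

/-- Entries of a matrix bounded by a summable function of the distance to the diagonal add up to
at most a constant times the number of rows. -/
theorem exists_sum_sum_le_mul_of_summable {c : ℕ → ℝ} (hc0 : ∀ k, 0 ≤ c k) (hc : Summable c) :
    ∃ S : ℝ, 0 ≤ S ∧ ∀ (r : ℕ → ℕ → ℝ) (n : ℕ),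
      (∀ s ∈ Finset.Icc 1 n, ∀ t ∈ Finset.Icc 1 n, r s t ≤ c ((t : ℤ) - s).natAbs) →
      ∑ s ∈ Finset.Icc 1 n, ∑ t ∈ Finset.Icc 1 n, r s t ≤ n * S := by
  have hd : Summable fun z : ℤ => c z.natAbs :=
    Summable.of_nat_of_neg (by simpa using hc) (by simpa using hc)
  refine ⟨∑' z : ℤ, c z.natAbs, tsum_nonneg fun _ => hc0 _, fun r n hr => ?_⟩
  have hrow : ∀ s ∈ Finset.Icc 1 n, ∑ t ∈ Finset.Icc 1 n, r s t ≤ ∑' z : ℤ, c z.natAbs := by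
    intro s hs
    have hinj : Function.Injective fun t : ℕ => (t : ℤ) - s := fun a b hab => by
      simpa using hab
    calc ∑ t ∈ Finset.Icc 1 n, r s t ≤ ∑ t ∈ Finset.Icc 1 n, c ((t : ℤ) - s).natAbs :=
          Finset.sum_le_sum (hr s hs)
      _ ≤ ∑' t : ℕ, c ((t : ℤ) - s).natAbs :=
          (hd.comp_injective hinj).sum_le_tsum _ fun _ _ => hc0 _
      _ ≤ _ := tsum_comp_le_tsum_of_inj hd (fun _ => hc0 _) hinj
  simpa using Finset.sum_le_card_nsmul _ _ _ hrow

/-- Bound for the covariance of `X_s X_{s+h}` and `X_{s+k} X_{s+k+h}` in terms of the lag `k`. -/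
theorem abs_cov_lagged_products_le {Ω : Type*} [MeasurableSpace Ω] {P : Measure Ω}
    [IsProbabilityMeasure P] {X : ℕ → Ω → ℝ} {δ B : ℝ} (hδ : 0 < δ) (h : ℕ)
    (hX : ∀ t, Measurable (X t))
    (hmom : ∀ t, 1 ≤ t → Integrable (fun ω => |X t ω * X (t + h) ω| ^ (2 + δ)) P ∧
      ∫ ω, |X t ω * X (t + h) ω| ^ (2 + δ) ∂P ≤ B)
    {s k : ℕ} (hs : 1 ≤ s) :
    |cov P (fun ω => X s ω * X (s + h) ω) fun ω => X (s + k) ω * X (s + k + h) ω|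
      ≤ 4 * (1 + B) * (if k < h + 2 then 1 else mixCoef P X (k - (h + 2)) ^ (δ / (2 + δ))) := by
  obtain ⟨h1, hsC⟩ := hmom s hs
  obtain ⟨h2, htC⟩ := hmom (s + k) (by omega)
  split_ifs with hk
  · nth_rw 2 [← Real.one_rpow (δ / (2 + δ))]
    exact abs_cov_le_rpow le_rfl le_rfl zero_le_one hδ
      (fun A B _ _ => abs_measure_inter_sub_mul_le_one P A B)
      ((hX s).mul (hX (s + h))) ((hX (s + k)).mul (hX (s + k + h))) h1 hsC h2 htC
  · exact abs_cov_le_rpow (sigLT_le hX (s + h + 1)) (sigGT_le hX (s + h + 1 + (k - (h + 2))))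
      (mixCoef_nonneg P X _) hδ
      (fun A B hA hB => abs_measure_inter_sub_mul_le_mixCoef P X _ _ hA hB)
      ((measurable_sigLT X hs (by omega)).mul (measurable_sigLT X (by omega) (by omega)))
      ((measurable_sigGT X (by omega)).mul (measurable_sigGT X (by omega))) h1 hsC h2 htC

/-- `‖γ̃_n(h) − γ(h)‖_{L²(P)} = O(n^{−1/2})` for a strictly stationary zero-mean strong
mixing process with `sup_t E|X_t|^{4+2δ} < ∞` and `∑_k α_X(k)^{δ/(2+δ)} < ∞`. -/
theorem tildeGamma_L2_rate
    {Ω : Type*} [𝓕 : MeasurableSpace Ω] (P : Measure Ω) [IsProbabilityMeasure P]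
    (X : ℕ → Ω → ℝ) (δ : ℝ) (hδ : 0 < δ) (h : ℕ)
    (hmeas : ∀ t, Measurable (X t))
    (hstat : IsStrictlyStationary P X)
    (hzero : ∀ t, 1 ≤ t → Integrable (X t) P ∧ (∫ ω, X t ω ∂P) = 0)
    (hmom : ∃ B : ℝ, ∀ t, 1 ≤ t → Integrable (fun ω => |X t ω| ^ (4 + 2 * δ)) P ∧
      (∫ ω, |X t ω| ^ (4 + 2 * δ) ∂P) ≤ B)
    (hsm : Filter.Tendsto (mixCoef P X) Filter.atTop (nhds 0))
    (hmix : Summable (fun j : ℕ => mixCoef P X (j + 1) ^ (δ / (2 + δ)))) :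
    ∃ K : ℝ, ∀ n : ℕ, 1 ≤ n →
      l2norm P (fun ω => tildeGamma X n h ω - acov P X h) ≤ K * (n : ℝ) ^ (-(1 : ℝ) / 2) := by
  obtain ⟨B, hB⟩ := hmom
  set Y : ℕ → Ω → ℝ := fun t ω => X t ω * X (t + h) ω with hYdef
  have hY : ∀ t, Measurable (Y t) := fun t => (hmeas t).mul (hmeas (t + h))
  have hYmom : ∀ t, 1 ≤ t → Integrable (fun ω => |Y t ω| ^ (2 + δ)) P ∧
      ∫ ω, |Y t ω| ^ (2 + δ) ∂P ≤ B := fun t ht =>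
    integrable_rpow_abs_mul (hmeas t) (hmeas (t + h)) (hB t ht).1 (hB t ht).2
      (hB (t + h) (by omega)).1 (hB (t + h) (by omega)).2
  have hY2 : ∀ t, 1 ≤ t → MemLp (Y t) 2 P := fun t ht =>
    memLp_two_of_integrable_rpow hδ (hY t).aestronglyMeasurable (hYmom t ht).1
  have hB0 : 0 ≤ B :=
    (integral_nonneg fun ω => Real.rpow_nonneg (abs_nonneg _) _).trans (hYmom 1 le_rfl).2
  set c : ℕ → ℝ := fun k =>
    4 * (1 + B) * (if k < h + 2 then 1 else mixCoef P X (k - (h + 2)) ^ (δ / (2 + δ))) with hcdef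
  have hc0 : ∀ k, 0 ≤ c k := fun k => by
    have := Real.rpow_nonneg (mixCoef_nonneg P X (k - (h + 2))) (δ / (2 + δ))
    simp only [hcdef]
    split_ifs <;> positivity
  have hc : Summable c := by
    rw [← summable_nat_add_iff (h + 3)]
    refine (hmix.mul_left (4 * (1 + B))).congr fun j => ?_
    simp only [hcdef]
    rw [if_neg (by omega), show j + (h + 3) - (h + 2) = j + 1 by omega]
  have hle : ∀ s t, 1 ≤ s → s ≤ t → cov P (Y s) (Y t) ≤ c (t - s) := by
    intro s t hs hst
    obtain ⟨k, rfl⟩ := Nat.exists_eq_add_of_le hst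
    rw [Nat.add_sub_cancel_left]
    exact (le_abs_self _).trans (abs_cov_lagged_products_le hδ h hmeas hYmom hs)
  obtain ⟨S, hS0, hS⟩ := exists_sum_sum_le_mul_of_summable hc0 hc
  refine ⟨Real.sqrt S, fun n hn => ?_⟩
  have hn0 : (0 : ℝ) < n := by exact_mod_cast hn
  have hmean : ∫ ω, tildeGamma X n h ω ∂P = acov P X h := by
    simp only [tildeGamma]
    rw [integral_const_mul, integral_finsetSum _ fun t ht =>
      (hY2 t (Finset.mem_Icc.mp ht).1).integrable one_le_two,
      Finset.sum_congr rfl fun t ht =>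
        integral_mul_eq_acov hmeas hstat h (Finset.mem_Icc.mp ht).1]
    simp
    field_simp
  have hsumcov : ∑ s ∈ Finset.Icc 1 n, ∑ t ∈ Finset.Icc 1 n, covariance (Y s) (Y t) P
      ≤ n * S := by
    refine hS _ n fun s hs t ht => ?_
    rw [Finset.mem_Icc] at hs ht
    rw [covariance_eq_sub (hY2 s hs.1) (hY2 t ht.1)]
    rcases le_total s t with hst | hst
    · rw [show ((t : ℤ) - s).natAbs = t - s by omega]
      exact hle s t hs.1 hst
    · rw [show ((t : ℤ) - s).natAbs = s - t by omega]
      exact (cov_comm P (Y s) (Y t)).trans_le (hle t s ht.1 hst)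
  have hvar : ∫ ω, (tildeGamma X n h ω - acov P X h) ^ 2 ∂P ≤ S * (n : ℝ)⁻¹ := by
    have hm : Measurable (tildeGamma X n h) :=
      (Finset.measurable_fun_sum _ fun t _ => hY t).const_mul _
    rw [← hmean, ← variance_eq_integral hm.aemeasurable]
    change variance (fun ω => 1 / (n : ℝ) * ∑ t ∈ Finset.Icc 1 n, Y t ω) P ≤ _
    rw [variance_const_mul, variance_fun_sum' fun t ht => hY2 t (Finset.mem_Icc.mp ht).1]
    calc _ ≤ (1 / (n : ℝ)) ^ 2 * (n * S) := by gcongr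
      _ = _ := by field_simp
  calc l2norm P (fun ω => tildeGamma X n h ω - acov P X h)
      ≤ Real.sqrt (S * (n : ℝ)⁻¹) := Real.sqrt_le_sqrt hvar
    _ = Real.sqrt S * (n : ℝ) ^ (-(1 : ℝ) / 2) := by
      rw [Real.sqrt_mul hS0, Real.sqrt_inv, Real.sqrt_eq_rpow (n : ℝ), ← Real.rpow_neg hn0.le]
      norm_num
end
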